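/- Assume q < 1 and L < ∞; for each λ ∈ Σ let y_λ : ℝ → X be continuously differentiable with |y_λ'(t) − A(t)y_λ(t) − f_λ(t, y_λ(t))| ≤ ε(t) for all t ∈ ℝ, let k ∈ ℕ, and suppose there is C > 0 such that conditions (R1) and (R2) hold. Then the map (λ, z) ↦ 𝒯_λ z is C^k with respect to z on an open subset of Σ × 𝒴 containing 𝒮 := {(λ, z_{λ̄}) : λ, λ̄ ∈ Σ}, and for 1 ≤ i ≤ k its i-th partial derivative in z is given by ((∂^i_z 𝒯_λ z)(η₁,…,η_i))(t) = ∫_ℝ 𝒢(t,τ) (∂^i_x f_λ(τ, y_λ(τ) + z(τ)))(η₁(τ),…,η_i(τ)) dτ for η₁,…,η_i ∈ 𝒴 and t ∈ ℝ. -/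

import Mathlib

open MeasureTheory Set

section Evolution

variable {X : Type*} [NormedAddCommGroup X] [NormedSpace ℝ X]
  {A : ℝ → X →L[ℝ] X} {T : ℝ → ℝ → X →L[ℝ] X} {P : ℝ → X →L[ℝ] X} {G : ℝ → ℝ → X →L[ℝ] X}

theorem evolution_comp (hA : Continuous A) (hTid : ∀ s, T s s = 1)
    (hT : ∀ s t, HasDerivAt (fun r => T r s) ((A t).comp (T t s)) t) (t r s : ℝ) :
    T t s = (T t r).comp (T r s) := by
  set a := min t r - 1 with ha
  set b := max t r + 1 with hb
  have hta : a < t := by have := min_le_left t r; linarith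
  have hra : a < r := by have := min_le_right t r; linarith
  have htb : t < b := by have := le_max_left t r; linarith
  have hrb : r < b := by have := le_max_right t r; linarith
  obtain ⟨K, hK⟩ := (isCompact_Icc (a := a) (b := b)).exists_bound_of_continuousOn
    hA.continuousOn
  have hK0 : 0 ≤ K := (norm_nonneg _).trans (hK t ⟨hta.le, htb.le⟩)
  have hlip : ∀ u ∈ Ioo a b,
      LipschitzOnWith K.toNNReal (fun B : X →L[ℝ] X => (A u).comp B) univ := by
    intro u hu
    refine LipschitzOnWith.of_dist_le_mul fun B₁ _ B₂ _ => ?_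
    rw [dist_eq_norm, dist_eq_norm, Real.coe_toNNReal _ hK0, ← ContinuousLinearMap.comp_sub]
    exact (ContinuousLinearMap.opNorm_comp_le _ _).trans
      (mul_le_mul_of_nonneg_right (hK u (Ioo_subset_Icc_self hu)) (norm_nonneg _))
  refine ODE_solution_unique_of_mem_Ioo (f := fun u => T u s)
    (g := fun u => (T u r).comp (T r s)) (t₀ := r) hlip ⟨hra, hrb⟩
    (fun u _ => ⟨hT s u, mem_univ _⟩) (fun u _ => ⟨?_, mem_univ _⟩) ?_ ⟨hta, htb⟩
  · simpa [ContinuousLinearMap.comp_assoc] using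
      (hT r u).clm_comp (hasDerivAt_const u (T r s))
  · simp [hTid, ContinuousLinearMap.one_def]

theorem evolution_continuous_right [CompleteSpace X] (hA : Continuous A) (hTid : ∀ s, T s s = 1)
    (hT : ∀ s t, HasDerivAt (fun r => T r s) ((A t).comp (T t s)) t) (t : ℝ) :
    Continuous (T t) := by
  have hinv : ∀ s, T t s = Ring.inverse (T s t) := fun s => by
    let u : (X →L[ℝ] X)ˣ :=
      ⟨T s t, T t s, (evolution_comp hA hTid hT s t s).symm.trans (hTid s),
        (evolution_comp hA hTid hT t s t).symm.trans (hTid t)⟩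
    exact (Ring.inverse_unit u).symm
  rw [continuous_iff_continuousAt]
  intro s
  rw [show T t = fun s => Ring.inverse (T s t) from funext hinv]
  let u : (X →L[ℝ] X)ˣ :=
      ⟨T s t, T t s, (evolution_comp hA hTid hT s t s).symm.trans (hTid s),
        (evolution_comp hA hTid hT t s t).symm.trans (hTid t)⟩
  exact ContinuousAt.comp (g := Ring.inverse) (NormedRing.inverse_continuousAt u)
    (hT t s).continuousAt

theorem green_aestronglyMeasurable [CompleteSpace X] (hA : Continuous A) (hTid : ∀ s, T s s = 1)
    (hT : ∀ s t, HasDerivAt (fun r => T r s) ((A t).comp (T t s)) t) (hP : Continuous P)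
    (hG : ∀ t s, G t s = if s ≤ t then (T t s).comp (P s) else -((T t s).comp (1 - P s)))
    (t : ℝ) : AEStronglyMeasurable (G t) volume := by
  have hTc := evolution_continuous_right hA hTid hT t
  rw [show G t = fun s => if s ≤ t then (T t s).comp (P s) else -((T t s).comp (1 - P s))
    from funext (hG t)]
  exact (StronglyMeasurable.ite measurableSet_Iic
    (hTc.clm_comp hP).stronglyMeasurable
    ((hTc.clm_comp (continuous_const.sub hP)).neg).stronglyMeasurable).aestronglyMeasurable

theorem continuous_integral_green (hA : Continuous A) (hTid : ∀ s, T s s = 1)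
    (hT : ∀ s t, HasDerivAt (fun r => T r s) ((A t).comp (T t s)) t)
    (hG : ∀ t s, G t s = if s ≤ t then (T t s).comp (P s) else -((T t s).comp (1 - P s)))
    [CompleteSpace X] {h : ℝ → X} (hint : ∀ t, Integrable (fun s => G t s (h s))) :
    Continuous (fun t => ∫ s, G t s (h s)) := by
  set H : ℝ → ℝ → X := fun t s => T 0 t (G t s (h s)) with hH
  have hHint : ∀ t, Integrable (H t) := fun t => (T 0 t).integrable_comp (hint t)
  have hHle : ∀ t s, s ≤ t → H t s = T 0 s (P s (h s)) := fun t s hs => by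
    simp only [hH, hG, if_pos hs]
    rw [evolution_comp hA hTid hT 0 t s]; rfl
  have hHgt : ∀ t s, t < s → H t s = -T 0 s (h s - P s (h s)) := fun t s hs => by
    simp only [hH, hG, if_neg hs.not_ge]
    rw [evolution_comp hA hTid hT 0 t s]; simp
  have hcont : Continuous fun t => ∫ s, H t s := by
    rw [continuous_iff_continuousAt]
    intro t₀
    refine MeasureTheory.continuousAt_of_dominated
      (bound := fun s => ‖H (t₀ - 1) s‖ + ‖H (t₀ + 1) s‖)
      (Filter.Eventually.of_forall fun t => (hHint t).aestronglyMeasurable) ?_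
      ((hHint _).norm.add (hHint _).norm) ?_
    · filter_upwards [Ioo_mem_nhds (show t₀ - 1 < t₀ by linarith)
        (show t₀ < t₀ + 1 by linarith)] with t ht
      refine Filter.Eventually.of_forall fun s => ?_
      rcases le_or_gt s t with hs | hs
      · rw [hHle t s hs, hHle (t₀ + 1) s (hs.trans ht.2.le)]
        exact le_add_of_nonneg_left (norm_nonneg _)
      · rw [hHgt t s hs, hHgt (t₀ - 1) s (ht.1.trans hs)]
        exact le_add_of_nonneg_right (norm_nonneg _)
    · filter_upwards [Measure.ae_ne volume t₀] with s hs
      rcases lt_or_gt_of_ne hs with hs | hs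
      · refine continuousAt_const.congr (f := fun _ => T 0 s (P s (h s))) ?_
        filter_upwards [Ioi_mem_nhds hs] with t ht using (hHle t s (le_of_lt ht)).symm
      · refine continuousAt_const.congr (f := fun _ => -T 0 s (h s - P s (h s))) ?_
        filter_upwards [Iio_mem_nhds hs] with t ht using (hHgt t s ht).symm
  have hT0 : Continuous fun t => T t 0 :=
    continuous_iff_continuousAt.2 fun t => (hT 0 t).continuousAt
  refine (hT0.clm_apply hcont).congr fun t => ?_
  rw [(T 0 t).integral_comp_comm (hint t)]
  change ((T t 0).comp (T 0 t)) _ = _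
  rw [← evolution_comp hA hTid hT t 0 t, hTid]
  rfl

end Evolution

section Nemytskii

variable {X : Type*} [NormedAddCommGroup X] [NormedSpace ℝ X]

theorem norm_sub_sub_fderiv_le_sq {V : Type*} [NormedAddCommGroup V] [NormedSpace ℝ V]
    {φ : X → V} {B : ℝ} (hφ : Differentiable ℝ φ)
    (hL : ∀ x y, ‖fderiv ℝ φ y - fderiv ℝ φ x‖ ≤ B * ‖y - x‖) (hB : 0 ≤ B) (x y : X) :
    ‖φ y - φ x - fderiv ℝ φ x (y - x)‖ ≤ B * ‖y - x‖ ^ 2 := by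
  have := Convex.norm_image_sub_le_of_norm_hasFDerivWithin_le' (f := φ) (C := B * ‖y - x‖)
    (s := Metric.closedBall x ‖y - x‖) (x := x) (y := y) (f' := fderiv ℝ φ)
    (φ := fderiv ℝ φ x) (fun w _ => (hφ w).hasFDerivAt.hasFDerivWithinAt)
    (fun w hw => (hL x w).trans (mul_le_mul_of_nonneg_left
      (by simpa [dist_eq_norm] using hw) hB))
    (convex_closedBall _ _) (Metric.mem_closedBall_self (norm_nonneg _))
    (by simp [dist_eq_norm])
  linarith

theorem norm_iteratedFDeriv_sub_le {g : X → X} {B : ℝ} {m : ℕ}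
    (hg : ContDiff ℝ ((m + 1 : ℕ) : ℕ∞) g) (hB : ∀ ξ, ‖iteratedFDeriv ℝ (m + 1) g ξ‖ ≤ B) (x y : X) :
    ‖iteratedFDeriv ℝ m g y - iteratedFDeriv ℝ m g x‖ ≤ B * ‖y - x‖ := by
  have hd : Differentiable ℝ (iteratedFDeriv ℝ m g) :=
    hg.differentiable_iteratedFDeriv (by exact_mod_cast m.lt_succ_self)
  exact Convex.norm_image_sub_le_of_norm_fderiv_le (s := univ) (fun w _ => hd w)
    (fun w _ => norm_fderiv_iteratedFDeriv.trans_le (hB w)) convex_univ trivial trivial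

theorem norm_iteratedFDeriv_taylor_le {g : X → X} {B : ℝ} {m : ℕ}
    (hg : ContDiff ℝ ((m + 2 : ℕ) : ℕ∞) g) (hB : ∀ ξ, ‖iteratedFDeriv ℝ (m + 2) g ξ‖ ≤ B) (x y : X)
    (η : Fin m → X) :
    ‖iteratedFDeriv ℝ m g y η - iteratedFDeriv ℝ m g x η
      - iteratedFDeriv ℝ (m + 1) g x (Fin.cons (y - x) η)‖ ≤ B * ‖y - x‖ ^ 2 * ∏ j, ‖η j‖ := by
  have hd : Differentiable ℝ (iteratedFDeriv ℝ m g) :=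
    hg.differentiable_iteratedFDeriv (by exact_mod_cast (by omega : m < m + 2))
  have hL : ∀ x y, ‖fderiv ℝ (iteratedFDeriv ℝ m g) y - fderiv ℝ (iteratedFDeriv ℝ m g) x‖
      ≤ B * ‖y - x‖ := by
    intro x y
    have := norm_iteratedFDeriv_sub_le (m := m + 1) hg hB x y
    rw [iteratedFDeriv_succ_eq_comp_left, Function.comp_apply, Function.comp_apply,
      ← dist_eq_norm, LinearIsometryEquiv.dist_map, dist_eq_norm] at this
    exact this
  have h := norm_sub_sub_fderiv_le_sq hd hL ((norm_nonneg _).trans (hB x)) x y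
  rw [iteratedFDeriv_succ_apply_left]
  simp only [Fin.cons_zero, Fin.tail_cons]
  exact (ContinuousMultilinearMap.le_opNorm
    (iteratedFDeriv ℝ m g y - iteratedFDeriv ℝ m g x
      - fderiv ℝ (iteratedFDeriv ℝ m g) x (y - x)) η).trans
    (mul_le_mul_of_nonneg_right h (Finset.prod_nonneg fun _ _ => norm_nonneg _))

theorem stronglyMeasurable_iteratedFDeriv {g : ℝ → X → X} {n : ℕ}
    (hg : Continuous fun p : ℝ × X => g p.1 p.2) (hgC : ∀ s, ContDiff ℝ (n : ℕ∞) (g s))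
    {i : ℕ} (hi : i ≤ n) {w : ℝ → X} (hw : Continuous w) {η : Fin i → ℝ → X}
    (hη : ∀ j, Continuous (η j)) :
    StronglyMeasurable fun s => iteratedFDeriv ℝ i (g s) (w s) (fun j => η j s) := by
  induction i generalizing w with
  | zero =>
    simp only [iteratedFDeriv_zero_apply]
    exact (hg.comp (continuous_id.prodMk hw)).stronglyMeasurable
  | succ i ih =>
    have hlim : ∀ s, Filter.Tendsto (fun m : ℕ => (m : ℝ) •
        (iteratedFDeriv ℝ i (g s) (w s + (m : ℝ)⁻¹ • η 0 s) (fun j => η j.succ s)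
          - iteratedFDeriv ℝ i (g s) (w s) (fun j => η j.succ s))) Filter.atTop
        (nhds (iteratedFDeriv ℝ (i + 1) (g s) (w s) (fun j => η j s))) := by
      intro s
      have hd : Differentiable ℝ (iteratedFDeriv ℝ i (g s)) :=
        (hgC s).differentiable_iteratedFDeriv (by exact_mod_cast hi)
      have h := (hd (w s)).hasFDerivAt.lim (η 0 s) (c := fun m : ℕ => (m : ℝ)) (l := Filter.atTop)
        (by simpa using tendsto_natCast_atTop_atTop)
      exact ((ContinuousMultilinearMap.apply ℝ (fun _ : Fin i => X) X
        (fun j => η j.succ s)).continuous.tendsto _).comp h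
    refine stronglyMeasurable_of_tendsto Filter.atTop (fun m : ℕ => ?_)
      (tendsto_pi_nhds.2 hlim)
    exact ((ih (by omega) (hw.add ((hη 0).const_smul _)) (fun j => hη j.succ)).sub
      (ih (by omega) hw (fun j => hη j.succ))).const_smul _

end Nemytskii

section IntegralOperator

open scoped BoundedContinuousFunction

/-- A kernel `G` and a nonlinearity `g` that is smooth in its second variable, both controlled by
a weight `B` which is integrable against `‖G t ·‖` uniformly in `t`. -/
structure GreenNemytskii {X : Type*} [NormedAddCommGroup X] [NormedSpace ℝ X]
    (k : ℕ) (G : ℝ → ℝ → X →L[ℝ] X) (g : ℝ → X → X) (B : ℝ → ℝ) (K : ℝ) : Prop where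
  measurable_kernel : ∀ t, AEStronglyMeasurable (G t) volume
  continuous_integral : ∀ h : ℝ → X, (∀ t, Integrable (fun s => G t s (h s))) →
    Continuous (fun t => ∫ s, G t s (h s))
  continuous_nonlinearity : Continuous fun p : ℝ × X => g p.1 p.2
  contDiff : ∀ s, ContDiff ℝ ((k + 1 : ℕ) : ℕ∞) (g s)
  norm_le : ∀ s ξ, ‖g s ξ‖ ≤ B s * (1 + ‖ξ‖)
  norm_iteratedFDeriv_le : ∀ i : ℕ, 1 ≤ i → i ≤ k + 1 → ∀ s ξ,
    ‖iteratedFDeriv ℝ i (g s) ξ‖ ≤ B s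
  integrable_weight : ∀ t, Integrable (fun s => B s * ‖G t s‖)
  integral_weight_le : ∀ t, (∫ s, B s * ‖G t s‖) ≤ K

variable {X : Type*} [NormedAddCommGroup X] [NormedSpace ℝ X]

theorem norm_integral_kernel_le {G : ℝ → X →L[ℝ] X} {B : ℝ → ℝ} {K R : ℝ} {h : ℝ → X}
    (hint : Integrable (fun s => B s * ‖G s‖)) (hK : (∫ s, B s * ‖G s‖) ≤ K) (hR : 0 ≤ R)
    (hh : ∀ s, ‖h s‖ ≤ B s * R) : ‖∫ s, G s (h s)‖ ≤ K * R := by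
  refine (norm_integral_le_of_norm_le (hint.mul_const R)
    (Filter.Eventually.of_forall fun s => ?_)).trans ?_
  · calc ‖G s (h s)‖ ≤ ‖G s‖ * (B s * R) := (G s).le_opNorm_of_le (hh s)
      _ = B s * ‖G s‖ * R := by ring
  · rw [integral_mul_const]
    exact mul_le_mul_of_nonneg_right hK hR

namespace GreenNemytskii

variable {k : ℕ} {G : ℝ → ℝ → X →L[ℝ] X} {g : ℝ → X → X} {B : ℝ → ℝ} {K : ℝ}

theorem weight_nonneg (H : GreenNemytskii k G g B K) (s : ℝ) : 0 ≤ B s := by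
  simpa using (norm_nonneg _).trans (H.norm_le s 0)

theorem bound_nonneg (H : GreenNemytskii k G g B K) : 0 ≤ K :=
  (integral_nonneg fun s => mul_nonneg (H.weight_nonneg s) (norm_nonneg _)).trans
    (H.integral_weight_le 0)

theorem norm_apply_le (H : GreenNemytskii k G g B K) {i : ℕ} (hi : i ≤ k) (z : ℝ →ᵇ X)
    (η : Fin i → ℝ →ᵇ X) (s : ℝ) :
    ‖iteratedFDeriv ℝ i (g s) (z s) (fun j => η j s)‖ ≤ B s * ((1 + ‖z‖) * ∏ j, ‖η j‖) := by
  have hD : ‖iteratedFDeriv ℝ i (g s) (z s)‖ ≤ B s * (1 + ‖z‖) := by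
    have hB := H.weight_nonneg s
    rcases Nat.eq_zero_or_pos i with rfl | hpos
    · rw [norm_iteratedFDeriv_zero]
      exact (H.norm_le s _).trans (mul_le_mul_of_nonneg_left
        (add_le_add_right (z.norm_coe_le_norm s) 1) hB)
    · exact (H.norm_iteratedFDeriv_le i hpos (by omega) s _).trans
        (le_mul_of_one_le_right hB (le_add_of_nonneg_right (norm_nonneg _)))
  rw [← mul_assoc]
  exact (ContinuousMultilinearMap.le_opNorm _ _).trans (mul_le_mul hD
    (Finset.prod_le_prod (fun _ _ => norm_nonneg _) fun j _ => (η j).norm_coe_le_norm s)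
    (Finset.prod_nonneg fun _ _ => norm_nonneg _) ((norm_nonneg _).trans hD))

theorem integrable_apply (H : GreenNemytskii k G g B K) {i : ℕ} (hi : i ≤ k) (z : ℝ →ᵇ X)
    (η : Fin i → ℝ →ᵇ X) (t : ℝ) :
    Integrable (fun s => G t s (iteratedFDeriv ℝ i (g s) (z s) (fun j => η j s))) := by
  refine ((H.integrable_weight t).mul_const ((1 + ‖z‖) * ∏ j, ‖η j‖)).mono' ?_
    (Filter.Eventually.of_forall fun s => ?_)
  · exact (ContinuousLinearMap.id ℝ (X →L[ℝ] X)).aestronglyMeasurable_comp₂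
      (H.measurable_kernel t)
      (stronglyMeasurable_iteratedFDeriv H.continuous_nonlinearity H.contDiff (by omega)
        z.continuous fun j => (η j).continuous).aestronglyMeasurable
  · calc _ ≤ ‖G t s‖ * (B s * ((1 + ‖z‖) * ∏ j, ‖η j‖)) :=
          (G t s).le_opNorm_of_le (H.norm_apply_le hi z η s)
      _ = B s * ‖G t s‖ * ((1 + ‖z‖) * ∏ j, ‖η j‖) := by ring

theorem exists_multilinear (H : GreenNemytskii k G g B K) (z : ℝ →ᵇ X) {i : ℕ} (hi : i ≤ k) :
    ∃ M : (ℝ →ᵇ X) [×i]→L[ℝ] (ℝ →ᵇ X), ∀ η t, M η t =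
      ∫ s, G t s (iteratedFDeriv ℝ i (g s) (z s) (fun j => η j s)) := by
  have hR : ∀ η : Fin i → ℝ →ᵇ X, 0 ≤ (1 + ‖z‖) * ∏ j, ‖η j‖ := fun η =>
    mul_nonneg (by positivity) (Finset.prod_nonneg fun _ _ => norm_nonneg _)
  have hbd : ∀ (η : Fin i → ℝ →ᵇ X) t,
      ‖∫ s, G t s (iteratedFDeriv ℝ i (g s) (z s) (fun j => η j s))‖
        ≤ K * ((1 + ‖z‖) * ∏ j, ‖η j‖) := fun η t =>
    norm_integral_kernel_le (H.integrable_weight t) (H.integral_weight_le t) (hR η)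
      (H.norm_apply_le hi z η)
  have hupd : ∀ [DecidableEq (Fin i)] (η : Fin i → ℝ →ᵇ X) (j : Fin i) (a : ℝ →ᵇ X) (s : ℝ),
      (fun l => Function.update η j a l s) = Function.update (fun l => η l s) j (a s) := by
    intro _ η j a s
    funext l
    rcases eq_or_ne l j with rfl | h
    · simp
    · simp [h]
  let M₀ : MultilinearMap ℝ (fun _ : Fin i => ℝ →ᵇ X) (ℝ →ᵇ X) :=
    { toFun := fun η => BoundedContinuousFunction.ofNormedAddCommGroup
        (fun t => ∫ s, G t s (iteratedFDeriv ℝ i (g s) (z s) (fun j => η j s)))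
        (H.continuous_integral _ (H.integrable_apply hi z η)) _ (hbd η)
      map_update_add' := by
        intro _ η j a b
        ext t
        simp only [BoundedContinuousFunction.coe_ofNormedAddCommGroup,
          BoundedContinuousFunction.add_apply]
        rw [← integral_add (H.integrable_apply hi z _ t) (H.integrable_apply hi z _ t)]
        simp only [hupd, BoundedContinuousFunction.add_apply,
          ContinuousMultilinearMap.map_update_add, map_add]
      map_update_smul' := by
        intro _ η j c a
        ext t
        simp only [BoundedContinuousFunction.coe_ofNormedAddCommGroup,
          BoundedContinuousFunction.smul_apply]
        rw [← integral_smul]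
        simp only [hupd, BoundedContinuousFunction.smul_apply,
          ContinuousMultilinearMap.map_update_smul, map_smul] }
  refine ⟨M₀.mkContinuous (K * (1 + ‖z‖)) fun η => ?_, fun η t => rfl⟩
  refine (BoundedContinuousFunction.norm_le (by
    rw [mul_assoc]; exact mul_nonneg H.bound_nonneg (hR η))).2 fun t => ?_
  rw [mul_assoc]
  exact hbd η t

theorem norm_sub_le (H : GreenNemytskii k G g B K) {i : ℕ} (hi : i ≤ k) {z w : ℝ →ᵇ X}
    {M N : (ℝ →ᵇ X) [×i]→L[ℝ] (ℝ →ᵇ X)}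
    (hM : ∀ η t, M η t = ∫ s, G t s (iteratedFDeriv ℝ i (g s) (z s) (fun j => η j s)))
    (hN : ∀ η t, N η t = ∫ s, G t s (iteratedFDeriv ℝ i (g s) (w s) (fun j => η j s))) :
    ‖M - N‖ ≤ K * ‖z - w‖ := by
  have hK := H.bound_nonneg
  refine ContinuousMultilinearMap.opNorm_le_bound (by positivity) fun η => ?_
  have hp : 0 ≤ ∏ j, ‖η j‖ := Finset.prod_nonneg fun _ _ => norm_nonneg _
  refine (BoundedContinuousFunction.norm_le (by positivity)).2 fun t => ?_
  change ‖M η t - N η t‖ ≤ _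
  rw [hM, hN, ← integral_sub (H.integrable_apply hi z η t) (H.integrable_apply hi w η t)]
  simp only [← map_sub]
  rw [mul_assoc]
  refine norm_integral_kernel_le (H.integrable_weight t) (H.integral_weight_le t)
    (by positivity) fun s => ?_
  have hB := H.weight_nonneg s
  rw [← sub_apply, ← mul_assoc]
  have h := norm_iteratedFDeriv_sub_le (g := g s) (m := i)
    ((H.contDiff s).of_le (by exact_mod_cast Nat.succ_le_succ hi))
    (H.norm_iteratedFDeriv_le (i + 1) (by omega) (by omega) s) (w s) (z s)
  have h' : ‖z s - w s‖ ≤ ‖z - w‖ := (z - w).norm_coe_le_norm s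
  refine (ContinuousMultilinearMap.le_opNorm _ _).trans (mul_le_mul
    (h.trans (mul_le_mul_of_nonneg_left h' hB))
    (Finset.prod_le_prod (fun _ _ => norm_nonneg _) fun j _ => (η j).norm_coe_le_norm s)
    (Finset.prod_nonneg fun _ _ => norm_nonneg _) (by positivity))

theorem norm_taylor_le (H : GreenNemytskii k G g B K) {i : ℕ} (hi : i < k) {z w : ℝ →ᵇ X}
    {M N : (ℝ →ᵇ X) [×i]→L[ℝ] (ℝ →ᵇ X)} {D : (ℝ →ᵇ X) [×(i + 1)]→L[ℝ] (ℝ →ᵇ X)}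
    (hM : ∀ η t, M η t = ∫ s, G t s (iteratedFDeriv ℝ i (g s) (z s) (fun j => η j s)))
    (hN : ∀ η t, N η t = ∫ s, G t s (iteratedFDeriv ℝ i (g s) (w s) (fun j => η j s)))
    (hD : ∀ η t, D η t = ∫ s, G t s (iteratedFDeriv ℝ (i + 1) (g s) (w s) (fun j => η j s))) :
    ‖M - N - D.curryLeft (z - w)‖ ≤ K * ‖z - w‖ ^ 2 := by
  have hK := H.bound_nonneg
  refine ContinuousMultilinearMap.opNorm_le_bound (by positivity) fun η => ?_
  have hp : 0 ≤ ∏ j, ‖η j‖ := Finset.prod_nonneg fun _ _ => norm_nonneg _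
  refine (BoundedContinuousFunction.norm_le (by positivity)).2 fun t => ?_
  change ‖M η t - N η t - D (Fin.cons (z - w) η) t‖ ≤ _
  have hsub : Integrable fun s => G t s (iteratedFDeriv ℝ i (g s) (z s) fun j => η j s)
      - G t s (iteratedFDeriv ℝ i (g s) (w s) fun j => η j s) :=
    (H.integrable_apply hi.le z η t).sub (H.integrable_apply hi.le w η t)
  rw [hM, hN, hD,
    ← integral_sub (H.integrable_apply hi.le z η t) (H.integrable_apply hi.le w η t),
    ← integral_sub hsub (H.integrable_apply hi w _ t)]
  simp only [← map_sub]
  rw [mul_assoc]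
  refine norm_integral_kernel_le (H.integrable_weight t) (H.integral_weight_le t)
    (by positivity) fun s => ?_
  have hB := H.weight_nonneg s
  have hcons : (fun j => (Fin.cons (z - w) η : Fin (i + 1) → ℝ →ᵇ X) j s)
      = Fin.cons (z s - w s) fun j => η j s := by
    funext j
    refine Fin.cases ?_ (fun j => ?_) j <;> simp
  rw [hcons, ← mul_assoc]
  have h := norm_iteratedFDeriv_taylor_le (g := g s) (m := i)
    ((H.contDiff s).of_le (by exact_mod_cast Nat.succ_le_succ hi))
    (H.norm_iteratedFDeriv_le (i + 2) (by omega) (by omega) s) (w s) (z s) fun j => η j s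
  have h' : ‖z s - w s‖ ≤ ‖z - w‖ := (z - w).norm_coe_le_norm s
  refine h.trans (mul_le_mul (mul_le_mul_of_nonneg_left (by gcongr) hB)
    (Finset.prod_le_prod (fun _ _ => norm_nonneg _) fun j _ => (η j).norm_coe_le_norm s)
    (Finset.prod_nonneg fun _ _ => norm_nonneg _) (by positivity))

theorem contDiff_and_iteratedFDeriv (H : GreenNemytskii k G g B K)
    {F : (ℝ →ᵇ X) → ℝ →ᵇ X} (hF : ∀ z t, F z t = ∫ s, G t s (g s (z s))) :
    ContDiff ℝ (k : ℕ∞) F ∧ ∀ i ≤ k, ∀ z η t, iteratedFDeriv ℝ i F z η t =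
      ∫ s, G t s (iteratedFDeriv ℝ i (g s) (z s) (fun j => η j s)) := by
  have hex : ∀ (z : ℝ →ᵇ X) (i : ℕ), ∃ M : (ℝ →ᵇ X) [×i]→L[ℝ] (ℝ →ᵇ X), i ≤ k → ∀ η t, M η t =
      ∫ s, G t s (iteratedFDeriv ℝ i (g s) (z s) (fun j => η j s)) := fun z i => by
    by_cases hi : i ≤ k
    · obtain ⟨M, hM⟩ := H.exists_multilinear z hi
      exact ⟨M, fun _ => hM⟩
    · exact ⟨0, fun h => (hi h).elim⟩
  choose p hp using hex
  have hK := H.bound_nonneg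
  have hT : HasFTaylorSeriesUpTo ((k : ℕ∞) : WithTop ℕ∞) F p := by
    refine ⟨fun z => ?_, fun m hm z => ?_, fun m hm => ?_⟩
    · ext t
      rw [ContinuousMultilinearMap.curry0, hp z 0 (Nat.zero_le _), hF]
      simp
    · have hm : m < k := by exact_mod_cast hm
      refine HasFDerivAt.of_isLittleO (Asymptotics.IsBigO.trans_isLittleO
        (Asymptotics.IsBigO.of_bound K (Filter.Eventually.of_forall fun w => ?_))
        (Asymptotics.isLittleO_pow_sub_sub z one_lt_two))
      rw [norm_pow, norm_norm]
      exact H.norm_taylor_le hm (hp w m hm.le) (hp z m hm.le) (hp z (m + 1) hm)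
    · have hm : m ≤ k := by exact_mod_cast hm
      refine (LipschitzWith.of_dist_le_mul (K := K.toNNReal) fun z w => ?_).continuous
      rw [dist_eq_norm, dist_eq_norm, Real.coe_toNNReal _ hK]
      exact H.norm_sub_le hm (hp z m hm) (hp w m hm)
  refine ⟨hT.contDiff, fun i hi z η t => ?_⟩
  rw [← hT.eq_iteratedFDeriv (by exact_mod_cast hi) z, hp z i hi]

end GreenNemytskii

end IntegralOperator

section PartialDerivative

variable {X : Type*} [NormedAddCommGroup X] [NormedSpace ℝ X]
  {E : Type*} [NormedAddCommGroup E] [NormedSpace ℝ E]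

theorem norm_iteratedFDerivWithin_sub_le {F : E → X} {S U : Set E} {b : ℝ} {i n : ℕ}
    (hS : IsOpen S) (hF : ContDiffOn ℝ (n : ℕ∞) F S) (hi : i < n) (hUS : U ⊆ S)
    (hU : Convex ℝ U) (hb : ∀ x ∈ U, ‖iteratedFDerivWithin ℝ (i + 1) F S x‖ ≤ b) {x y : E}
    (hx : x ∈ U) (hy : y ∈ U) :
    ‖iteratedFDerivWithin ℝ i F S y - iteratedFDerivWithin ℝ i F S x‖ ≤ b * ‖y - x‖ := by
  have hd : DifferentiableOn ℝ (iteratedFDerivWithin ℝ i F S) S :=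
    hF.differentiableOn_iteratedFDerivWithin (by exact_mod_cast hi) hS.uniqueDiffOn
  exact Convex.norm_image_sub_le_of_norm_hasFDerivWithin_le
    (fun w hw => (hd w (hUS hw)).hasFDerivWithinAt.mono hUS)
    (fun w hw => norm_fderivWithin_iteratedFDerivWithin.trans_le (hb w hw)) hU hx hy

theorem norm_sub_le_of_norm_iteratedFDerivWithin_one_le {F : E → X} {S U : Set E} {b : ℝ} {n : ℕ}
    (hS : IsOpen S) (hF : ContDiffOn ℝ (n : ℕ∞) F S) (hn : 0 < n) (hUS : U ⊆ S)
    (hU : Convex ℝ U) (hb : ∀ x ∈ U, ‖iteratedFDerivWithin ℝ 1 F S x‖ ≤ b) {x y : E}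
    (hx : x ∈ U) (hy : y ∈ U) : ‖F y - F x‖ ≤ b * ‖y - x‖ := by
  have h := norm_iteratedFDerivWithin_sub_le hS hF hn hUS hU hb hx hy
  rwa [iteratedFDerivWithin_zero_eq_comp, Function.comp_apply, Function.comp_apply,
    ← dist_eq_norm, LinearIsometryEquiv.dist_map, dist_eq_norm] at h

theorem iteratedFDeriv_partial_right {F : E × X → X} {U : Set E} {i n : ℕ} (hU : IsOpen U)
    (hF : ContDiffOn ℝ (n : ℕ∞) F (U ×ˢ univ)) (hi : i ≤ n) {u : E} (hu : u ∈ U) (ξ : X) :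
    iteratedFDeriv ℝ i (fun ζ => F (u, ζ)) ξ =
      (iteratedFDerivWithin ℝ i F (U ×ˢ univ) (u, ξ)).compContinuousLinearMap
        fun _ => ContinuousLinearMap.inr ℝ E X := by
  have hS : IsOpen (U ×ˢ (univ : Set X)) := hU.prod isOpen_univ
  set a : E × X := (u, 0) with ha
  set S' : Set (E × X) := (fun p => a + p) ⁻¹' (U ×ˢ univ) with hS'
  have hS'o : IsOpen S' := hS.preimage (by fun_prop)
  have hpre : (ContinuousLinearMap.inr ℝ E X) ⁻¹' S' = univ := by
    ext ζ; simp [hS', ha, hu]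
  have hF' : ContDiffOn ℝ (n : ℕ∞) (fun p => F (a + p)) S' :=
    hF.comp (contDiff_const.add contDiff_id).contDiffOn fun p hp => hp
  have hmem : ContinuousLinearMap.inr ℝ E X ξ ∈ S' := by simp [hS', ha, hu]
  have h := (ContinuousLinearMap.inr ℝ E X).iteratedFDerivWithin_comp_right hF'
    hS'o.uniqueDiffOn (by rw [hpre]; exact uniqueDiffOn_univ) hmem
    (i := i) (by exact_mod_cast hi)
  rw [hpre, iteratedFDerivWithin_univ, iteratedFDerivWithin_of_isOpen i hS'o hmem,
    iteratedFDeriv_comp_add_left] at h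
  have haξ : a + ContinuousLinearMap.inr ℝ E X ξ = (u, ξ) := by simp [ha]
  rw [haξ, ← iteratedFDerivWithin_of_isOpen i hS (mk_mem_prod hu (mem_univ ξ))] at h
  rw [← h]
  congr 1
  funext ζ
  simp [ha]

theorem norm_iteratedFDeriv_partial_le {F : E × X → X} {U : Set E} {i n : ℕ} (hU : IsOpen U)
    (hF : ContDiffOn ℝ (n : ℕ∞) F (U ×ˢ univ)) (hi : i ≤ n) {u : E} (hu : u ∈ U) (ξ : X) :
    ‖iteratedFDeriv ℝ i (fun ζ => F (u, ζ)) ξ‖ ≤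
      ‖iteratedFDerivWithin ℝ i F (U ×ˢ univ) (u, ξ)‖ := by
  rw [iteratedFDeriv_partial_right hU hF hi hu]
  refine (ContinuousMultilinearMap.norm_compContinuousLinearMap_le _ _).trans
    (mul_le_of_le_one_right (norm_nonneg _) ?_)
  exact Finset.prod_le_one (fun _ _ => norm_nonneg _)
    fun _ _ => ContinuousLinearMap.norm_inr_le_one ℝ E X

theorem norm_iteratedFDeriv_partial_sub_le {F : E × X → X} {U V : Set E} {b : ℝ} {i n : ℕ}
    (hU : IsOpen U) (hF : ContDiffOn ℝ (n : ℕ∞) F (U ×ˢ univ)) (hi : i < n) (hVU : V ⊆ U)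
    (hV : Convex ℝ V)
    (hb : ∀ u ∈ U, ∀ ξ, ‖iteratedFDerivWithin ℝ (i + 1) F (U ×ˢ univ) (u, ξ)‖ ≤ b)
    {u v : E} (hu : u ∈ V) (hv : v ∈ V) (ξ ζ : X) :
    ‖iteratedFDeriv ℝ i (fun x => F (v, x)) ζ - iteratedFDeriv ℝ i (fun x => F (u, x)) ξ‖ ≤
      b * (‖v - u‖ + ‖ζ - ξ‖) := by
  have hb0 : 0 ≤ b := (norm_nonneg _).trans (hb u (hVU hu) ξ)
  rw [iteratedFDeriv_partial_right hU hF hi.le (hVU hv),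
    iteratedFDeriv_partial_right hU hF hi.le (hVU hu)]
  have h := norm_iteratedFDerivWithin_sub_le (hU.prod isOpen_univ) hF hi
    (prod_mono_left hVU) (hV.prod convex_univ) (fun p hp => hb p.1 (hVU hp.1) p.2)
    (x := (u, ξ)) (y := (v, ζ)) ⟨hu, trivial⟩ ⟨hv, trivial⟩
  have hle : ‖(v, ζ) - (u, ξ)‖ ≤ ‖v - u‖ + ‖ζ - ξ‖ := by
    rw [Prod.mk_sub_mk, Prod.norm_mk]
    exact max_le_add_of_nonneg (norm_nonneg _) (norm_nonneg _)
  refine le_trans ?_ (h.trans (mul_le_mul_of_nonneg_left hle hb0))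
  refine le_trans (le_of_eq_of_le ?_
    (ContinuousMultilinearMap.norm_compContinuousLinearMap_le
      (iteratedFDerivWithin ℝ i F (U ×ˢ univ) (v, ζ)
        - iteratedFDerivWithin ℝ i F (U ×ˢ univ) (u, ξ))
      fun _ => ContinuousLinearMap.inr ℝ E X))
    (mul_le_of_le_one_right (norm_nonneg _) (Finset.prod_le_one (fun _ _ => norm_nonneg _)
    fun _ _ => ContinuousLinearMap.norm_inr_le_one ℝ E X))
  rfl

end PartialDerivative

/-- Lemma: `C^k` regularity of `𝒯_λ z` in `z`. Under conditions (R1)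
and (R2), the map `z ↦ 𝒯_λ z` is `C^k` on an open set `𝒲 ⊆ Σ × 𝒴` containing
`𝒮 = {(λ, z_{λ̄})}`, and for `1 ≤ i ≤ k` its `i`-th partial derivative in `z` is
`((∂^i_z 𝒯_λ z)(η₁,…,η_i))(t) = ∫ 𝒢(t,τ)(∂^i_x f_λ(τ, y_λ(τ)+z(τ)))(η₁(τ),…,η_i(τ)) dτ`,
the `i`-th derivative map being continuous on `𝒲`. -/
theorem stmt7
    {X : Type*} [NormedAddCommGroup X] [NormedSpace ℝ X] [CompleteSpace X]
    {E : Type*} [NormedAddCommGroup E] [NormedSpace ℝ E]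
    (A : ℝ → X →L[ℝ] X) (hA : Continuous A)
    (T : ℝ → ℝ → X →L[ℝ] X)
    (hTid : ∀ s, T s s = 1)
    (hT : ∀ s t, HasDerivAt (fun r => T r s) ((A t).comp (T t s)) t)
    (P : ℝ → X →L[ℝ] X) (hP : Continuous P)
    (G : ℝ → ℝ → X →L[ℝ] X)
    (hG : ∀ t s, G t s = if s ≤ t then (T t s).comp (P s)
      else -((T t s).comp (1 - P s)))
    (Sg : Set E) (hSg : IsOpen Sg) (hSgne : Sg.Nonempty)
    (f : E → ℝ → X → X)
    (hf : ∀ lam ∈ Sg, Continuous (fun p : ℝ × X => f lam p.1 p.2))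
    (c : ℝ → ℝ) (hc : Continuous c) (hc0 : ∀ t, 0 ≤ c t)
    (hlip : ∀ lam ∈ Sg, ∀ t (x₁ x₂ : X),
      ‖f lam t x₁ - f lam t x₂‖ ≤ c t * ‖x₁ - x₂‖)
    (q : ℝ) (hq1 : q < 1)
    (hqint : ∀ t, Integrable (fun s => c s * ‖G t s‖))
    (hq : ∀ t, (∫ s, c s * ‖G t s‖) ≤ q)
    (eps : ℝ → ℝ) (heps : Continuous eps) (heps0 : ∀ t, 0 < eps t)
    (L : ℝ)
    (hLint : ∀ t, Integrable (fun s => eps s * ‖G t s‖))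
    (hL : ∀ t, (∫ s, eps s * ‖G t s‖) ≤ L)
    (y : E → ℝ → X) (y' : E → ℝ → X)
    (hy : ∀ lam ∈ Sg, ∀ t, HasDerivAt (y lam) (y' lam t) t)
    (hy'c : ∀ lam ∈ Sg, Continuous (y' lam))
    (hpse : ∀ lam ∈ Sg, ∀ t,
      ‖y' lam t - A t (y lam t) - f lam t (y lam t)‖ ≤ eps t)
    (k : ℕ) (C : ℝ) (hC : 0 < C)
    -- (R1)
    (hfC : ∀ t, ContDiffOn ℝ ((k : ℕ∞) + 1) (fun p : E × X => f p.1 t p.2) (Sg ×ˢ univ))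
    (hfbound : ∀ i : ℕ, 2 ≤ i → i ≤ k + 1 → ∀ t : ℝ, ∀ lam ∈ Sg, ∀ ξ : X,
      ‖iteratedFDerivWithin ℝ i (fun p : E × X => f p.1 t p.2) (Sg ×ˢ univ) (lam, ξ)‖
        ≤ C * eps t)
    -- (R2)
    (hyC : ∀ t, ContDiffOn ℝ ((k : ℕ∞) + 1) (fun lam => y lam t) Sg)
    (hy'C : ∀ t, ContDiffOn ℝ ((k : ℕ∞) + 1) (fun lam => y' lam t) Sg)
    (hR2 : ∀ i : ℕ, 1 ≤ i → i ≤ k + 1 → ∀ t : ℝ, ∀ lam ∈ Sg,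
      ‖iteratedFDerivWithin ℝ i (fun mu => y' mu t) Sg lam
        - (A t).compContinuousMultilinearMap
            (iteratedFDerivWithin ℝ i (fun mu => y mu t) Sg lam)
        - iteratedFDerivWithin ℝ i (fun mu => f mu t (y mu t)) Sg lam‖ ≤ C * eps t)
    (hM : ∀ lam₀ ∈ Sg, ∃ M : ℝ, 1 < M ∧ ∃ S₀ ∈ nhds lam₀, S₀ ⊆ Sg ∧
      ∀ lam ∈ S₀, ∀ i : ℕ, 1 ≤ i → i ≤ k + 1 → ∀ t : ℝ,
        ‖iteratedFDerivWithin ℝ i (fun mu => y mu t) Sg lam‖ ≤ M)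
    -- the operator 𝒯_λ and its fixed points z_λ
    (Top : E → BoundedContinuousFunction ℝ X → BoundedContinuousFunction ℝ X)
    (hTop : ∀ lam ∈ Sg, ∀ (z : BoundedContinuousFunction ℝ X) (t : ℝ),
      Top lam z t =
        ∫ s, G t s (A s (y lam s) + f lam s (y lam s + z s) - y' lam s))
    (z : E → BoundedContinuousFunction ℝ X)
    (hzfix : ∀ lam ∈ Sg, Top lam (z lam) = z lam)
    (hznorm : ∀ lam ∈ Sg, ‖z lam‖ ≤ L / (1 - q)) :
    ∃ W : Set (E × BoundedContinuousFunction ℝ X), IsOpen W ∧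
      {p : E × BoundedContinuousFunction ℝ X |
        p.1 ∈ Sg ∧ ∃ lam' ∈ Sg, p.2 = z lam'} ⊆ W ∧
      W ⊆ Sg ×ˢ univ ∧
      -- z ↦ 𝒯_λ z is k-times differentiable in z at every point of W
      (∀ p ∈ W, ContDiffAt ℝ (k : ℕ∞) (fun w => Top p.1 w) p.2) ∧
      ∀ i : ℕ, 1 ≤ i → i ≤ k →
        -- the i-th partial z-derivative is continuous on W
        ContinuousOn
          (fun p : E × BoundedContinuousFunction ℝ X =>
            iteratedFDeriv ℝ i (fun w => Top p.1 w) p.2) W ∧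
        -- and it is given by the integral formula
        ∀ p ∈ W, ∀ η : Fin i → BoundedContinuousFunction ℝ X, ∀ t : ℝ,
          (iteratedFDeriv ℝ i (fun w => Top p.1 w) p.2 η) t =
            ∫ τ, G t τ
              ((iteratedFDeriv ℝ i (fun ξ : X => f p.1 τ ξ) (y p.1 τ + p.2 τ))
                (fun j => η j τ)) := by
  have hfC' : ∀ t, ContDiffOn ℝ ((k + 1 : ℕ) : ℕ∞) (fun p : E × X => f p.1 t p.2)
      (Sg ×ˢ univ) := fun t => by exact_mod_cast hfC t
  have hyC' : ∀ t, ContDiffOn ℝ ((k + 1 : ℕ) : ℕ∞) (fun lam => y lam t) Sg :=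
    fun t => by exact_mod_cast hyC t
  have hfx : ∀ lam ∈ Sg, ∀ s, ContDiff ℝ ((k + 1 : ℕ) : ℕ∞) (f lam s) := by
    intro lam hlam s
    rw [← contDiffOn_univ]
    exact (hfC' s).comp (contDiff_const.prodMk contDiff_id).contDiffOn
      fun ξ _ => ⟨hlam, trivial⟩
  set g : E → ℝ → X → X := fun lam s ξ =>
    A s (y lam s) + f lam s (y lam s + ξ) - y' lam s with hg
  have hgf : ∀ lam ∈ Sg, ∀ i : ℕ, 1 ≤ i → i ≤ k + 1 → ∀ s ξ,
      iteratedFDeriv ℝ i (g lam s) ξ = iteratedFDeriv ℝ i (f lam s) (y lam s + ξ) := by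
    intro lam hlam i hi1 hik s ξ
    have hsm : ContDiffAt ℝ (i : ℕ∞) (fun ζ => f lam s (y lam s + ζ)) ξ :=
      (((hfx lam hlam s).of_le (by exact_mod_cast hik)).comp
        (contDiff_const.add contDiff_id)).contDiffAt
    have hsplit : g lam s = (fun ζ => f lam s (y lam s + ζ))
        + fun _ => A s (y lam s) - y' lam s := by
      funext ζ
      simp only [hg, Pi.add_apply]
      abel
    rw [hsplit, iteratedFDeriv_add_apply (by exact_mod_cast hsm) contDiffAt_const,
      iteratedFDeriv_const_of_ne (by omega), Pi.zero_apply, add_zero,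
      iteratedFDeriv_comp_add_left]
  have hH : ∀ lam ∈ Sg, GreenNemytskii k G (g lam) (fun s => c s + (1 + C) * eps s)
      (q + (1 + C) * L) := by
    intro lam hlam
    have hyc : Continuous (y lam) :=
      continuous_iff_continuousAt.2 fun t => (hy lam hlam t).continuousAt
    refine ⟨green_aestronglyMeasurable hA hTid hT hP hG,
      fun h hint => continuous_integral_green hA hTid hT hG hint, ?_, fun s => ?_, fun s ξ => ?_,
      fun i hi1 hik s ξ => ?_, fun t => ?_, fun t => ?_⟩
    · have hfc : Continuous fun p : ℝ × X => f lam p.1 (y lam p.1 + p.2) :=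
        (hf lam hlam).comp (continuous_fst.prodMk ((hyc.comp continuous_fst).add continuous_snd))
      exact (((hA.comp continuous_fst).clm_apply (hyc.comp continuous_fst)).add hfc).sub
        ((hy'c lam hlam).comp continuous_fst)
    · exact (contDiff_const.add ((hfx lam hlam s).comp
        (contDiff_const.add contDiff_id))).sub contDiff_const
    · have h1 := hpse lam hlam s
      have h2 := hlip lam hlam s (y lam s + ξ) (y lam s)
      rw [add_sub_cancel_left] at h2
      have hsplit : g lam s ξ = (f lam s (y lam s + ξ) - f lam s (y lam s))
          - (y' lam s - A s (y lam s) - f lam s (y lam s)) := by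
        simp only [hg]
        abel
      rw [hsplit]
      refine (norm_sub_le _ _).trans ((add_le_add h2 h1).trans ?_)
      have e1 := (heps0 s).le
      have e2 := hc0 s
      have e3 := norm_nonneg ξ
      have e4 := mul_nonneg e1 e3
      have e5 := mul_nonneg hC.le e1
      have e6 := mul_nonneg e5 e3
      linarith [mul_nonneg e2 e3]
    · rw [hgf lam hlam i hi1 hik]
      have e1 := (heps0 s).le
      have e2 := hc0 s
      have e5 := mul_nonneg hC.le e1
      rcases Nat.eq_or_lt_of_le hi1 with rfl | hi2
      · rw [norm_iteratedFDeriv_one]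
        have := norm_fderiv_le_of_lip' ℝ (f := f lam s) (x₀ := y lam s + ξ) e2
          (Filter.Eventually.of_forall fun x => hlip lam hlam s x _)
        linarith
      · have h1 := norm_iteratedFDeriv_partial_le hSg (hfC' s) hik hlam (y lam s + ξ)
        have h2 := hfbound i hi2 hik s lam hlam (y lam s + ξ)
        linarith
    · refine ((hqint t).add ((hLint t).const_mul (1 + C))).congr
        (Filter.Eventually.of_forall fun s => ?_)
      simp only [Pi.add_apply]
      ring
    · have : ∀ s, (c s + (1 + C) * eps s) * ‖G t s‖
          = c s * ‖G t s‖ + (1 + C) * (eps s * ‖G t s‖) := fun s => by ring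
      simp only [this]
      rw [integral_add (hqint t) ((hLint t).const_mul _), integral_const_mul]
      exact add_le_add (hq t) (mul_le_mul_of_nonneg_left (hL t) (by linarith))
  have hmain : ∀ lam (hlam : lam ∈ Sg), _ := fun lam hlam =>
    (hH lam hlam).contDiff_and_iteratedFDeriv (hTop lam hlam)
  have hform : ∀ lam ∈ Sg, ∀ i : ℕ, 1 ≤ i → i ≤ k → ∀ w η t,
      iteratedFDeriv ℝ i (fun w => Top lam w) w η t =
        ∫ τ, G t τ (iteratedFDeriv ℝ i (f lam τ) (y lam τ + w τ) (fun j => η j τ)) := by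
    intro lam hlam i hi1 hik w η t
    refine ((hmain lam hlam).2 i hik w η t).trans ?_
    simp only [hgf lam hlam i hi1 (by omega)]
  have hint : ∀ lam ∈ Sg, ∀ i : ℕ, 1 ≤ i → i ≤ k →
      ∀ (w : BoundedContinuousFunction ℝ X) (η : Fin i → BoundedContinuousFunction ℝ X) t,
      Integrable fun τ => G t τ
        (iteratedFDeriv ℝ i (f lam τ) (y lam τ + w τ) (fun j => η j τ)) := by
    intro lam hlam i hi1 hik w η t
    have := (hH lam hlam).integrable_apply hik w η t
    simpa only [hgf lam hlam i hi1 (by omega)] using this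
  have hL0 : 0 ≤ L := (integral_nonneg fun s =>
    mul_nonneg (heps0 s).le (norm_nonneg (G 0 s))).trans (hL 0)
  refine ⟨Sg ×ˢ univ, hSg.prod isOpen_univ, fun p hp => ⟨hp.1, trivial⟩, subset_rfl,
    fun p hp => (hmain p.1 hp.1).1.contDiffAt, fun i hi1 hik => ⟨?_, fun p hp η t =>
      hform p.1 hp.1 i hi1 hik p.2 η t⟩⟩
  rintro ⟨lam₀, w₀⟩ ⟨hlam₀, -⟩
  obtain ⟨M, hM1, S₀, hS₀, hS₀Sg, hMb⟩ := hM lam₀ hlam₀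
  obtain ⟨r, hr, hball⟩ := Metric.mem_nhds_iff.1 hS₀
  have hballSg : Metric.ball lam₀ r ⊆ Sg := hball.trans hS₀Sg
  have hmem₀ : lam₀ ∈ Metric.ball lam₀ r := Metric.mem_ball_self hr
  have hest : ∀ lam ∈ Metric.ball lam₀ r, ∀ w : BoundedContinuousFunction ℝ X,
      ‖iteratedFDeriv ℝ i (fun w => Top lam w) w
        - iteratedFDeriv ℝ i (fun w => Top lam₀ w) w₀‖
        ≤ L * (C * ((1 + M) * ‖lam - lam₀‖ + ‖w - w₀‖)) := by
    intro lam hlam w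
    have hlamS := hballSg hlam
    have hd0 : 0 ≤ (1 + M) * ‖lam - lam₀‖ := mul_nonneg (by linarith) (norm_nonneg _)
    have hR0 : 0 ≤ C * ((1 + M) * ‖lam - lam₀‖ + ‖w - w₀‖) :=
      mul_nonneg hC.le (add_nonneg hd0 (norm_nonneg _))
    refine ContinuousMultilinearMap.opNorm_le_bound (mul_nonneg hL0 hR0) fun η => ?_
    have hp : 0 ≤ ∏ j, ‖η j‖ := Finset.prod_nonneg fun _ _ => norm_nonneg _
    refine (BoundedContinuousFunction.norm_le (mul_nonneg (mul_nonneg hL0 hR0) hp)).2 fun t => ?_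
    change ‖iteratedFDeriv ℝ i (fun w => Top lam w) w η t
        - iteratedFDeriv ℝ i (fun w => Top lam₀ w) w₀ η t‖ ≤ _
    rw [hform lam hlamS i hi1 hik, hform lam₀ hlam₀ i hi1 hik,
      ← integral_sub (hint lam hlamS i hi1 hik w η t) (hint lam₀ hlam₀ i hi1 hik w₀ η t)]
    simp only [← map_sub]
    rw [mul_assoc]
    refine norm_integral_kernel_le (hLint t) (hL t) (mul_nonneg hR0 hp) fun s => ?_
    have h1 := norm_iteratedFDeriv_partial_sub_le hSg (hfC' s) (Nat.lt_succ_of_le hik) hballSg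
      (convex_ball lam₀ r)
      (fun mu hmu ξ => hfbound (i + 1) (by omega) (by omega) s mu hmu ξ) hmem₀ hlam
      (y lam₀ s + w₀ s) (y lam s + w s)
    have h2 := norm_sub_le_of_norm_iteratedFDerivWithin_one_le hSg (hyC' s) k.succ_pos hballSg
      (convex_ball lam₀ r) (fun mu hmu => hMb mu (hball hmu) 1 le_rfl (by omega) s) hmem₀ hlam
    have h3 : ‖w s - w₀ s‖ ≤ ‖w - w₀‖ := (w - w₀).norm_coe_le_norm s
    have h4 : ‖(y lam s + w s) - (y lam₀ s + w₀ s)‖ ≤ M * ‖lam - lam₀‖ + ‖w - w₀‖ := by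
      rw [add_sub_add_comm]
      exact (norm_add_le _ _).trans (add_le_add h2 h3)
    have h5 : ‖iteratedFDeriv ℝ i (f lam s) (y lam s + w s)
        - iteratedFDeriv ℝ i (f lam₀ s) (y lam₀ s + w₀ s)‖
        ≤ eps s * (C * ((1 + M) * ‖lam - lam₀‖ + ‖w - w₀‖)) := by
      refine h1.trans ((mul_le_mul_of_nonneg_left
        (add_le_add_right h4 _) (mul_pos hC (heps0 s)).le).trans_eq ?_)
      ring
    rw [← mul_assoc]
    exact (ContinuousMultilinearMap.le_opNorm (iteratedFDeriv ℝ i (f lam s) (y lam s + w s)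
        - iteratedFDeriv ℝ i (f lam₀ s) (y lam₀ s + w₀ s)) fun j => η j s).trans
      (mul_le_mul h5
        (Finset.prod_le_prod (fun _ _ => norm_nonneg _) fun j _ => (η j).norm_coe_le_norm s)
        (Finset.prod_nonneg fun _ _ => norm_nonneg _) (mul_nonneg (heps0 s).le hR0))
  refine ContinuousAt.continuousWithinAt (tendsto_iff_norm_sub_tendsto_zero.2 ?_)
  have hbd : Continuous fun p : E × BoundedContinuousFunction ℝ X =>
      L * (C * ((1 + M) * ‖p.1 - lam₀‖ + ‖p.2 - w₀‖)) := by fun_prop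
  refine squeeze_zero' (Filter.Eventually.of_forall fun _ => norm_nonneg _) ?_
    ((hbd.tendsto' (lam₀, w₀) 0 (by simp)))
  filter_upwards [(continuous_fst.tendsto (lam₀, w₀)).eventually (Metric.ball_mem_nhds lam₀ hr)]
    with p hp using hest p.1 hp p.2
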